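/- Let Γ be a finite group and let x ∈ Γ have order n = 2^t · m with m odd, t ≥ 3, and m ≡ 3 (mod 4). Then ⟦x⟧ = x^{m}·⟦x²⟧ ∪ x^{m}·⟦x⁻²⟧ = x^{m}·[x²]. -/

import Mathlib

noncomputable section

/-- `[x] = {y : ⟨y⟩ = ⟨x⟩}`. -/
def atom1 {Γ : Type*} [Group Γ] (x : Γ) : Set Γ :=
  {y | Subgroup.zpowers y = Subgroup.zpowers x}

/-- `⟦x⟧ = {x^k : 1 ≤ k ≤ ord(x)−1, gcd(k, ord(x)) = 1, k ≡ 1 (mod 4)}`. -/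
def bracket4 {Γ : Type*} [Group Γ] (x : Γ) : Set Γ :=
  {y | ∃ k : ℕ, 1 ≤ k ∧ k ≤ orderOf x - 1 ∧ Nat.gcd k (orderOf x) = 1 ∧ k % 4 = 1 ∧ y = x ^ k}

theorem mem_atom1_iff {Γ : Type*} [Group Γ] {x y : Γ} :
    y ∈ atom1 x ↔ ∃ k : ℤ, IsCoprime k (orderOf x : ℤ) ∧ y = x ^ k := by
  constructor
  · intro h
    obtain ⟨k, rfl⟩ : y ∈ Subgroup.zpowers x := h ▸ Subgroup.mem_zpowers y
    obtain ⟨j, hj⟩ : x ∈ Subgroup.zpowers (x ^ k) :=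
      (show Subgroup.zpowers (x ^ k) = _ from h) ▸ Subgroup.mem_zpowers x
    refine ⟨k, ?_, rfl⟩
    have hx : x ^ (1 - k * j) = 1 := by
      rw [zpow_sub, zpow_mul, zpow_one, show (x ^ k) ^ j = x from hj, mul_inv_cancel]
    obtain ⟨c, hc⟩ := orderOf_dvd_iff_zpow_eq_one.mpr hx
    exact ⟨j, c, by linarith⟩
  · rintro ⟨k, ⟨a, b, hab⟩, rfl⟩
    refine le_antisymm (Subgroup.zpowers_le.mpr ⟨k, rfl⟩) (Subgroup.zpowers_le.mpr ⟨a, ?_⟩)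
    change (x ^ k) ^ a = x
    rw [← zpow_mul, show k * a = 1 - orderOf x * b by linarith, zpow_sub, zpow_mul x (orderOf x : ℤ),
      zpow_natCast, pow_orderOf_eq_one, one_zpow, inv_one, mul_one, zpow_one]

theorem mem_bracket4_iff {Γ : Type*} [Group Γ] [Finite Γ] {x y : Γ} (h4 : 4 ∣ orderOf x) :
    y ∈ bracket4 x ↔ ∃ k : ℤ, IsCoprime k (orderOf x : ℤ) ∧ k % 4 = 1 ∧ y = x ^ k := by
  have hpos := orderOf_pos x
  constructor
  · rintro ⟨k, -, -, hk, hk4, rfl⟩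
    exact ⟨k, Nat.isCoprime_iff_coprime.mpr hk, by omega, (zpow_natCast x k).symm⟩
  · rintro ⟨k, hk, hk4, rfl⟩
    have hnonneg : 0 ≤ k % orderOf x := Int.emod_nonneg _ (by omega)
    have hlt : k % orderOf x < orderOf x := Int.emod_lt_of_pos _ (by omega)
    have hmod : k % orderOf x % 4 = k % 4 := Int.emod_emod_of_dvd k (mod_cast h4)
    have hcop : IsCoprime (k % orderOf x) (orderOf x : ℤ) := by
      rw [Int.emod_def, sub_eq_add_neg, ← mul_neg]
      exact hk.add_mul_left_left _
    have hpow : x ^ k = x ^ (k % orderOf x) := (zpow_mod_orderOf x k).symm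
    obtain ⟨l, hl⟩ := Int.eq_ofNat_of_zero_le hnonneg
    rw [hl] at hlt hmod hcop hpow
    exact ⟨l, by omega, by omega, Nat.isCoprime_iff_coprime.mp hcop, by omega,
      hpow.trans (zpow_natCast x l)⟩

theorem bracket4_union_bracket4_inv {Γ : Type*} [Group Γ] [Finite Γ] {x : Γ}
    (h4 : 4 ∣ orderOf x) : bracket4 x ∪ bracket4 x⁻¹ = atom1 x := by
  ext y
  rw [Set.mem_union, mem_bracket4_iff h4, mem_bracket4_iff ((orderOf_inv x).symm ▸ h4),
    mem_atom1_iff, orderOf_inv]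
  constructor
  · rintro (⟨k, hk, -, rfl⟩ | ⟨k, hk, -, rfl⟩)
    · exact ⟨k, hk, rfl⟩
    · exact ⟨-k, hk.neg_left, inv_zpow' x k⟩
  · rintro ⟨k, hk, rfl⟩
    have hodd : k % 2 = 1 := by
      have h2 : (2 : ℤ) ∣ orderOf x := by omega
      exact Int.odd_iff.mp (Int.isCoprime_two_right.mp (hk.of_isCoprime_of_dvd_right h2))
    rcases (by omega : k % 4 = 1 ∨ k % 4 = 3) with h | h
    · exact .inl ⟨k, hk, h, rfl⟩
    · exact .inr ⟨-k, hk.neg_left, by omega, by rw [inv_zpow', neg_neg]⟩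

theorem isCoprime_two_pow_mul_iff {k m : ℤ} {t : ℕ} (ht : t ≠ 0) :
    IsCoprime k (2 ^ t * m) ↔ k % 2 = 1 ∧ IsCoprime k m := by
  rw [IsCoprime.mul_right_iff, IsCoprime.pow_right_iff (Nat.pos_of_ne_zero ht),
    Int.isCoprime_two_right, Int.odd_iff]

/-- If `x` has order `n = 2^t·m` with `m` odd, `t ≥ 3` and `m ≡ 3 (mod 4)`, then
`⟦x⟧ = x^{m}·⟦x²⟧ ∪ x^{m}·⟦x⁻²⟧ = x^{m}·[x²]`. -/
theorem bracket4_eq_translate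
    (Γ : Type*) [Group Γ] [Fintype Γ] (x : Γ) (t m : ℕ)
    (hord : orderOf x = 2 ^ t * m) (hm : Odd m) (ht : 3 ≤ t) (hm4 : m % 4 = 3) :
    bracket4 x = (fun s => x ^ m * s) '' bracket4 (x ^ 2)
        ∪ (fun s => x ^ m * s) '' bracket4 ((x ^ 2)⁻¹)
      ∧ bracket4 x = (fun s => x ^ m * s) '' atom1 (x ^ 2) := by
  obtain ⟨s, rfl⟩ : ∃ s, t = s + 1 := ⟨t - 1, by omega⟩
  have hs : s ≠ 0 := by omega
  have hord2 : orderOf (x ^ 2) = 2 ^ s * m := by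
    have hdvd : 2 ∣ orderOf x := hord ▸ ⟨2 ^ s * m, by ring⟩
    rw [orderOf_pow_of_dvd two_ne_zero hdvd, hord]
    exact Nat.div_eq_of_eq_mul_left two_pos (by ring)
  have h4' : 4 ∣ orderOf (x ^ 2) :=
    hord2 ▸ (pow_dvd_pow 2 (show 2 ≤ s by omega)).mul_right m
  have h4 : 4 ∣ orderOf x := h4'.trans (orderOf_pow_dvd 2)
  rw [← Set.image_union, bracket4_union_bracket4_inv h4', and_self]
  ext y
  simp only [Set.mem_image, mem_bracket4_iff h4, mem_atom1_iff, hord, hord2,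
    Nat.cast_mul, Nat.cast_pow, Nat.cast_ofNat, isCoprime_two_pow_mul_iff hs,
    isCoprime_two_pow_mul_iff s.succ_ne_zero]
  have h2m : IsCoprime (2 : ℤ) m :=
    Int.isCoprime_two_left.mpr (mod_cast hm)
  have hcop (j : ℤ) : IsCoprime (m + 2 * j) (m : ℤ) ↔ IsCoprime j (m : ℤ) := by
    refine Iff.trans ?_ (IsCoprime.mul_left_iff.trans (and_iff_right h2m))
    simpa using IsCoprime.mul_add_left_left_iff (x := 2 * j) (y := (m : ℤ)) (z := 1)
  have hpow (j : ℤ) : x ^ m * (x ^ 2) ^ j = x ^ (m + 2 * j : ℤ) := by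
    rw [zpow_add, zpow_mul, zpow_natCast, zpow_ofNat]
  constructor
  · rintro ⟨k, ⟨-, hk⟩, hk4, rfl⟩
    obtain ⟨j, rfl⟩ : ∃ j : ℤ, k = m + 2 * j := ⟨(k - m) / 2, by omega⟩
    exact ⟨_, ⟨j, ⟨by omega, (hcop j).mp hk⟩, rfl⟩, hpow j⟩
  · rintro ⟨_, ⟨j, ⟨hj, hjm⟩, rfl⟩, rfl⟩
    exact ⟨m + 2 * j, ⟨by omega, (hcop j).mpr hjm⟩, by omega, hpow j⟩
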